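/- Let r ≥ 1, γ > 0, ℏ > 0, and 1 ≤ k ≤ r. For q ∈ ℝ^r with nonzero coordinates and pairwise distinct squares, define φ_k(q) = ∑_{l=0}^{k} (−1)^l · C(r+l−k, l) · ( ∏_{m=0}^{l−1} (r−k+γ+ℏ/2+m) ) · E_{k−l}(q), where C(·,·) is the binomial coefficient, the empty product (l = 0) equals 1, and E_m = e_m(q₁²,…,q_r²) is the degree-m elementary symmetric polynomial of the squared coordinates. Then φ_k is a quantum eigenfunction of the reduced B_r Calogero system with eigenvalue 2kℏ: −(ℏ²/2) Δφ_k − ℏ ∑_{j=1}^r ∂W/∂q_j ∂φ_k/∂q_j = 2kℏ φ_k, where W = ∑_{j<l} log(q_j² − q_l²) + γ ∑_j log q_j − (1/2)q². -/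

import Mathlib

/-- Partial derivative `∂f/∂q_j` of a function on `ℝ^r`. -/
noncomputable def pd {r : ℕ} (f : (Fin r → ℝ) → ℝ) (j : Fin r) (q : Fin r → ℝ) : ℝ :=
  fderiv ℝ f q (Pi.single j 1)

/-- The degree-`k` elementary symmetric polynomial of `q₁,…,q_n`. -/
noncomputable def esym {n : ℕ} (k : ℕ) (q : Fin n → ℝ) : ℝ :=
  ∑ t ∈ Finset.univ.powersetCard k, ∏ i ∈ t, q i

open Finset

/-- The elementary symmetric sum of degree `m` in the variables indexed by `s`. -/
noncomputable def esymOn {n : ℕ} (s : Finset (Fin n)) (m : ℕ) (x : Fin n → ℝ) : ℝ :=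
  ∑ t ∈ s.powersetCard m, ∏ i ∈ t, x i

/-- `esymOn s (m - 1)`, with value `0` at `m = 0`. -/
noncomputable def esymOnPred {n : ℕ} (s : Finset (Fin n)) : ℕ → (Fin n → ℝ) → ℝ
  | 0 => fun _ => 0
  | m + 1 => esymOn s m

lemma esymOn_zero {n : ℕ} (s : Finset (Fin n)) (x : Fin n → ℝ) : esymOn s 0 x = 1 := by
  simp [esymOn]

lemma esymOn_insert {n : ℕ} {s : Finset (Fin n)} {j : Fin n} (hj : j ∉ s) (m : ℕ)
    (x : Fin n → ℝ) :
    esymOn (insert j s) (m + 1) x = esymOn s (m + 1) x + x j * esymOn s m x := by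
  unfold esymOn
  have hnot : ∀ t ∈ s.powersetCard m, j ∉ t := fun t ht h => hj ((mem_powersetCard.1 ht).1 h)
  rw [powersetCard_succ_insert hj, sum_union, sum_image, mul_sum]
  · congr 1
    exact sum_congr rfl fun t ht => prod_insert (hnot t ht)
  · intro t ht u hu h
    rw [← erase_insert (hnot t ht), ← erase_insert (hnot u hu), h]
  · rw [disjoint_left]
    intro t ht h
    obtain ⟨u, -, rfl⟩ := mem_image.1 h
    exact hj ((mem_powersetCard.1 ht).1 (mem_insert_self j u))

lemma esymOn_erase {n : ℕ} {s : Finset (Fin n)} {j : Fin n} (hj : j ∈ s) (m : ℕ)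
    (x : Fin n → ℝ) :
    esymOn s (m + 1) x = esymOn (s.erase j) (m + 1) x + x j * esymOn (s.erase j) m x := by
  rw [← esymOn_insert (notMem_erase j s), insert_erase hj]

lemma esymOn_congr {n : ℕ} {s : Finset (Fin n)} {x y : Fin n → ℝ} (h : ∀ i ∈ s, x i = y i)
    (m : ℕ) : esymOn s m x = esymOn s m y :=
  sum_congr rfl fun _ ht => prod_congr rfl fun i hi => h i ((mem_powersetCard.1 ht).1 hi)

lemma sum_esymOn_erase {n : ℕ} (s : Finset (Fin n)) (m : ℕ) (x : Fin n → ℝ) :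
    ∑ j ∈ s, esymOn (s.erase j) m x = ((#s : ℝ) - m) * esymOn s m x := by
  unfold esymOn
  have hcomm : ∑ j ∈ s, ∑ t ∈ (s.erase j).powersetCard m, ∏ i ∈ t, x i
      = ∑ t ∈ s.powersetCard m, ∑ j ∈ s \ t, ∏ i ∈ t, x i := by
    refine sum_comm' fun j t => ?_
    simp only [mem_powersetCard, mem_sdiff, subset_erase]
    tauto
  rw [hcomm, mul_sum]
  refine sum_congr rfl fun t ht => ?_
  obtain ⟨hts, hc⟩ := mem_powersetCard.1 ht
  rw [sum_const, nsmul_eq_mul, card_sdiff_of_subset hts, Nat.cast_sub (card_le_card hts), hc]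

lemma sum_mul_esymOn_erase {n : ℕ} (s : Finset (Fin n)) (m : ℕ) (x : Fin n → ℝ) :
    ∑ j ∈ s, x j * esymOn (s.erase j) m x = ((m : ℝ) + 1) * esymOn s (m + 1) x := by
  have h : ∑ j ∈ s, esymOn s (m + 1) x
      = ∑ j ∈ s, esymOn (s.erase j) (m + 1) x + ∑ j ∈ s, x j * esymOn (s.erase j) m x := by
    rw [← sum_add_distrib]
    exact sum_congr rfl fun j hj => esymOn_erase hj m x
  rw [sum_esymOn_erase, sum_const, nsmul_eq_mul] at h
  push_cast at h
  linarith

lemma mul_esymOn_erase_sub {n : ℕ} {s : Finset (Fin n)} {j l : Fin n} (hj : j ∈ s) (hl : l ∈ s)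
    (hjl : j ≠ l) (m : ℕ) (x : Fin n → ℝ) :
    x j * esymOn (s.erase j) m x - x l * esymOn (s.erase l) m x
      = (x j - x l) * esymOn ((s.erase j).erase l) m x := by
  cases m with
  | zero => simp [esymOn_zero]
  | succ m =>
    rw [esymOn_erase (mem_erase.2 ⟨hjl.symm, hl⟩ : l ∈ s.erase j),
      esymOn_erase (mem_erase.2 ⟨hjl, hj⟩ : j ∈ s.erase l), erase_right_comm (a := l)]
    ring

lemma sum_sum_erase_comm {n : ℕ} (f : Fin n → Fin n → ℝ) :
    ∑ j, ∑ l ∈ univ.erase j, f j l = ∑ j, ∑ l ∈ univ.erase j, f l j := by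
  refine sum_comm' fun j l => ?_
  simp [eq_comm]

lemma sum_div_sub_mul_esymOn {n : ℕ} {x : Fin n → ℝ} (hx : Function.Injective x) (m : ℕ) :
    ∑ j, ∑ l ∈ univ.erase j, x j / (x j - x l) * esymOn (univ.erase j) m x
      = (1 / 2) * ((n : ℝ) - 1 - m) * ((n : ℝ) - m) * esymOn univ m x := by
  have hsym := sum_sum_erase_comm fun j l => x j / (x j - x l) * esymOn (univ.erase j) m x
  have hadd : ∑ j, ∑ l ∈ univ.erase j, x j / (x j - x l) * esymOn (univ.erase j) m x
      + ∑ j, ∑ l ∈ univ.erase j, x l / (x l - x j) * esymOn (univ.erase l) m x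
      = ∑ j, ∑ l ∈ univ.erase j, esymOn ((univ.erase j).erase l) m x := by
    rw [← sum_add_distrib]
    refine sum_congr rfl fun j _ => ?_
    rw [← sum_add_distrib]
    refine sum_congr rfl fun l hl => ?_
    have hjl : j ≠ l := (ne_of_mem_erase hl).symm
    have hne : x j - x l ≠ 0 := sub_ne_zero.2 (hx.ne hjl)
    have h := mul_esymOn_erase_sub (mem_univ j) (mem_univ l) hjl m x
    rw [← neg_sub (x j) (x l), div_neg]
    field_simp
    linarith
  have hcount : ∑ j, ∑ l ∈ univ.erase j, esymOn ((univ.erase j).erase l) m x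
      = ((n : ℝ) - 1 - m) * (((n : ℝ) - m) * esymOn univ m x) := by
    have h2 := sum_esymOn_erase (univ : Finset (Fin n)) m x
    rw [card_univ, Fintype.card_fin] at h2
    rw [← h2, mul_sum]
    refine sum_congr rfl fun j _ => ?_
    rw [sum_esymOn_erase, card_erase_of_mem (mem_univ j), card_univ, Fintype.card_fin,
      Nat.cast_sub (Nat.one_le_of_lt j.2), Nat.cast_one]
  linarith

lemma pd_eq_of_hasDerivAt_update {r : ℕ} {f : (Fin r → ℝ) → ℝ} {j : Fin r} {q : Fin r → ℝ} {c : ℝ}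
    (hf : DifferentiableAt ℝ f q)
    (h : HasDerivAt (fun t => f (Function.update q j t)) c (q j)) : pd f j q = c := by
  have hf' : HasFDerivAt f (fderiv ℝ f q) (Function.update q j (q j)) := by
    rw [Function.update_eq_self]
    exact hf.hasFDerivAt
  exact (hf'.comp_hasDerivAt (q j) (hasDerivAt_update q j (q j))).unique h

lemma pd_sum_mul {r : ℕ} (s : Finset ℕ) (c : ℕ → ℝ) {f : ℕ → (Fin r → ℝ) → ℝ}
    (hf : ∀ l, Differentiable ℝ (f l)) (j : Fin r) :
    pd (fun q => ∑ l ∈ s, c l * f l q) j = fun q => ∑ l ∈ s, c l * pd (f l) j q := by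
  funext q
  unfold pd
  rw [fderiv_fun_sum fun l _ => ((hf l).const_mul (c l)).differentiableAt]
  simp only [_root_.sum_apply]
  refine sum_congr rfl fun l _ => ?_
  rw [fderiv_const_mul (hf l).differentiableAt]
  simp

lemma differentiable_esymOn_sq {r : ℕ} (s : Finset (Fin r)) (m : ℕ) :
    Differentiable ℝ fun q : Fin r → ℝ => esymOn s m fun i => q i ^ 2 := by
  unfold esymOn
  fun_prop

lemma differentiable_esymOnPred_sq {r : ℕ} (s : Finset (Fin r)) (m : ℕ) :
    Differentiable ℝ fun q : Fin r → ℝ => esymOnPred s m fun i => q i ^ 2 := by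
  cases m with
  | zero => exact differentiable_const 0
  | succ m => exact differentiable_esymOn_sq s m

lemma esymOn_erase_update_sq {r : ℕ} (s : Finset (Fin r)) (j : Fin r) (m : ℕ) (q : Fin r → ℝ)
    (t : ℝ) : esymOn (s.erase j) m (fun i => Function.update q j t i ^ 2)
      = esymOn (s.erase j) m fun i => q i ^ 2 :=
  esymOn_congr (fun i hi => by rw [Function.update_of_ne (ne_of_mem_erase hi)]) m

lemma esymOnPred_erase_update_sq {r : ℕ} (s : Finset (Fin r)) (j : Fin r) (m : ℕ) (q : Fin r → ℝ)
    (t : ℝ) : esymOnPred (s.erase j) m (fun i => Function.update q j t i ^ 2)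
      = esymOnPred (s.erase j) m fun i => q i ^ 2 := by
  cases m with
  | zero => rfl
  | succ m => exact esymOn_erase_update_sq s j m q t

lemma pd_esymOn_sq {r : ℕ} (m : ℕ) (j : Fin r) :
    pd (fun q => esymOn univ m fun i => q i ^ 2) j
      = fun q => 2 * q j * esymOnPred (univ.erase j) m fun i => q i ^ 2 := by
  funext q
  refine pd_eq_of_hasDerivAt_update (differentiable_esymOn_sq univ m).differentiableAt ?_
  cases m with
  | zero => simpa [esymOn_zero, esymOnPred] using hasDerivAt_const (q j) (1 : ℝ)
  | succ m =>
    simp only [esymOn_erase (mem_univ j), esymOn_erase_update_sq, Function.update_self]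
    simpa [esymOnPred] using ((hasDerivAt_pow 2 (q j)).mul_const
      (esymOn (univ.erase j) m fun i => q i ^ 2)).const_add
        (esymOn (univ.erase j) (m + 1) fun i => q i ^ 2)

lemma pd_pd_esymOn_sq {r : ℕ} (m : ℕ) (j : Fin r) (q : Fin r → ℝ) :
    pd (pd (fun q => esymOn univ m fun i => q i ^ 2) j) j q
      = 2 * esymOnPred (univ.erase j) m fun i => q i ^ 2 := by
  rw [pd_esymOn_sq]
  refine pd_eq_of_hasDerivAt_update ?_ ?_
  · have := differentiable_esymOnPred_sq (univ.erase j) m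
    fun_prop
  · simp only [esymOnPred_erase_update_sq, Function.update_self]
    simpa using ((hasDerivAt_id (q j)).const_mul 2).mul_const
      (esymOnPred (univ.erase j) m fun i => q i ^ 2)

lemma differentiable_pd_esymOn_sq {r : ℕ} (m : ℕ) (j : Fin r) :
    Differentiable ℝ (pd (fun q => esymOn univ m fun i => q i ^ 2) j) := by
  rw [pd_esymOn_sq]
  have := differentiable_esymOnPred_sq (univ.erase j) m
  fun_prop

lemma pd_apply {r : ℕ} (i j : Fin r) (q : Fin r → ℝ) :
    pd (fun q => q i) j q = if i = j then 1 else 0 := by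
  unfold pd
  rw [show (fun q : Fin r → ℝ => q i) = ContinuousLinearMap.proj (R := ℝ) (φ := fun _ => ℝ) i
    from rfl, ContinuousLinearMap.fderiv]
  simp [Pi.single_apply]

/-- The gradient of the `B_r` Calogero prepotential. -/
lemma pd_calogero_prepotential {r : ℕ} (γ : ℝ) {q : Fin r → ℝ} (hq : ∀ j, q j ≠ 0)
    (hinj : Function.Injective fun j => (q j) ^ 2) (a : Fin r) :
    pd (fun q => (∑ j, ∑ l ∈ Ioi j, Real.log ((q j) ^ 2 - (q l) ^ 2))
        + γ * (∑ j, Real.log (q j)) - (1 / 2) * (∑ j, (q j) ^ 2)) a q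
      = ∑ l ∈ univ.erase a, 2 * q a / (q a ^ 2 - q l ^ 2) + γ / q a - q a := by
  have hp : ∀ i : Fin r, HasFDerivAt (fun q : Fin r → ℝ => q i)
      (ContinuousLinearMap.proj (R := ℝ) (φ := fun _ => ℝ) i) q := fun i =>
    (ContinuousLinearMap.proj (R := ℝ) (φ := fun _ : Fin r => ℝ) i).hasFDerivAt
  have hpair : ∀ j : Fin r, ∀ l ∈ Ioi j, (q j) ^ 2 - (q l) ^ 2 ≠ 0 := fun j l hl =>
    sub_ne_zero.2 (hinj.ne (mem_Ioi.1 hl).ne)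
  have h := (((HasFDerivAt.fun_sum (u := univ) fun j _ =>
      HasFDerivAt.fun_sum fun l hl => (((hp j).pow 2).sub ((hp l).pow 2)).log (hpair j l hl)).add
    ((HasFDerivAt.fun_sum (u := univ) fun j _ => (hp j).log (hq j)).const_mul γ)).sub
    ((HasFDerivAt.fun_sum (u := univ) fun j _ => (hp j).pow 2).const_mul (1 / 2)))
  refine (DFunLike.congr_fun h.fderiv (Pi.single a 1)).trans ?_
  have hδ : ∀ i : Fin r, ContinuousLinearMap.proj (R := ℝ) (φ := fun _ => ℝ) i (Pi.single a 1)
      = if i = a then 1 else 0 := fun i => by simp [Pi.single_apply]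
  have hfst : ∑ i, ∑ l ∈ Ioi i, (if i = a then 2 * q i / (q i ^ 2 - q l ^ 2) else 0)
      = ∑ l ∈ Ioi a, 2 * q a / (q a ^ 2 - q l ^ 2) := by
    rw [sum_eq_single_of_mem a (mem_univ a) fun i _ hi => by simp [hi]]
    simp
  have hsnd : ∑ i, ∑ l ∈ Ioi i, (if l = a then 2 * q l / (q l ^ 2 - q i ^ 2) else 0)
      = ∑ i ∈ Iio a, 2 * q a / (q a ^ 2 - q i ^ 2) := by
    rw [sum_comm' (t' := univ) (s' := fun l => Iio l) fun i l => by simp,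
      sum_eq_single_of_mem a (mem_univ a) fun l _ hl => by simp [hl]]
    simp
  have herase : univ.erase a = (Ioi a).disjUnion (Iio a)
      (disjoint_left.2 fun l h₁ h₂ => lt_asymm (mem_Ioi.1 h₁) (mem_Iio.1 h₂)) := by
    ext l
    simp [or_comm, ← lt_or_lt_iff_ne]
  rw [herase, sum_disjUnion, ← hfst, ← hsnd, ← sum_add_distrib]
  simp only [_root_.sub_apply, _root_.add_apply, _root_.sum_apply, _root_.smul_apply, hδ,
    ← sum_add_distrib]
  congr 1
  · congr 1
    · refine sum_congr rfl fun i _ => ?_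
      refine sum_congr rfl fun l _ => ?_
      rw [← neg_sub (q i ^ 2) (q l ^ 2)]
      simp only [Pi.sub_apply, smul_eq_mul, nsmul_eq_mul, div_neg]
      split_ifs <;> simp <;> ring
    · simp [div_eq_mul_inv]
  · simp

lemma calogero_esymOn_sq {r : ℕ} (γ ℏ : ℝ) {q : Fin r → ℝ} (hq : ∀ j, q j ≠ 0)
    (hinj : Function.Injective fun j => (q j) ^ 2) (m : ℕ) :
    -(ℏ ^ 2 / 2) * (∑ j, pd (pd (fun q => esymOn univ m fun i => q i ^ 2) j) j q)
      - ℏ * (∑ j, (∑ l ∈ univ.erase j, 2 * q j / (q j ^ 2 - q l ^ 2) + γ / q j - q j)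
        * pd (fun q => esymOn univ m fun i => q i ^ 2) j q)
      = 2 * ℏ * m * (esymOn univ m fun i => q i ^ 2)
        - 2 * ℏ * (r - m + 1) * (r - m + γ + ℏ / 2) * esymOnPred univ m fun i => q i ^ 2 := by
  simp only [pd_pd_esymOn_sq]
  simp only [pd_esymOn_sq]
  cases m with
  | zero => simp [esymOnPred]
  | succ m =>
    simp only [esymOnPred]
    set x : Fin r → ℝ := fun i => q i ^ 2 with hx
    have h1 := sum_esymOn_erase univ m x
    have h2 := sum_mul_esymOn_erase univ m x
    have h3 := sum_div_sub_mul_esymOn hinj m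
    rw [card_univ, Fintype.card_fin] at h1
    have hterm : ∀ j, (∑ l ∈ univ.erase j, 2 * q j / (q j ^ 2 - q l ^ 2) + γ / q j - q j)
        * (2 * q j * esymOn (univ.erase j) m x)
        = 4 * (∑ l ∈ univ.erase j, x j / (x j - x l) * esymOn (univ.erase j) m x)
          + 2 * γ * esymOn (univ.erase j) m x - 2 * (x j * esymOn (univ.erase j) m x) := by
      intro j
      have hs : ∑ l ∈ univ.erase j, x j / (x j - x l) * esymOn (univ.erase j) m x
          = (∑ l ∈ univ.erase j, 2 * q j / (q j ^ 2 - q l ^ 2)) * (q j / 2)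
            * esymOn (univ.erase j) m x := by
        rw [sum_mul, sum_mul]
        refine sum_congr rfl fun l _ => ?_
        simp only [hx]
        ring
      have hqj := hq j
      rw [hs]
      simp only [hx]
      field_simp
      ring
    simp only [hterm, sum_sub_distrib, sum_add_distrib, ← mul_sum]
    rw [h1, h2, h3]
    push_cast
    ring

lemma succ_mul_choose_coeff {r k : ℕ} (hkr : k ≤ r) (l : ℕ) :
    ((l : ℝ) + 1) * ((r + (l + 1) - k).choose (l + 1) : ℝ)
      = ((r : ℝ) - k + l + 1) * ((r + l - k).choose l : ℝ) := by
  obtain ⟨d, rfl⟩ := Nat.exists_eq_add_of_le hkr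
  have e1 : k + d + (l + 1) - k = d + l + 1 := by omega
  have e2 : k + d + l - k = d + l := by omega
  have h := Nat.add_one_mul_choose_eq (d + l) l
  rw [e1, e2]
  have h' : ((d + l + 1 : ℕ) : ℝ) * ((d + l).choose l : ℝ)
      = ((d + l + 1).choose (l + 1) : ℝ) * ((l + 1 : ℕ) : ℝ) := by exact_mod_cast h
  push_cast at h' ⊢
  linarith

/-- The quantum eigenfunctions of the elementary excitations of the reduced `B_r`
Calogero system: `φ_k = ∑_l (−1)^l C(r+l−k,l) (Γ(r+l−k+γ+ℏ/2)/Γ(r−k+γ+ℏ/2)) S_{k−l}`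
satisfies `Ĥ φ_k = 2kℏ φ_k`. -/
theorem B_series_quantum_eigenfunctions (r : ℕ) (hr : 1 ≤ r)
    (γ : ℝ) (hγ : 0 < γ) (ℏ : ℝ) (hℏ : 0 < ℏ)
    (k : ℕ) (hk1 : 1 ≤ k) (hk2 : k ≤ r)
    (φ : (Fin r → ℝ) → ℝ)
    (hφ : ∀ q, φ q = ∑ l ∈ Finset.range (k + 1),
        (-1 : ℝ)^l * ((r + l - k).choose l : ℝ)
          * (∏ m ∈ Finset.range l, ((r : ℝ) - k + γ + ℏ/2 + m))
          * esym (k - l) (fun i => (q i)^2))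
    (W : (Fin r → ℝ) → ℝ)
    (hW : ∀ q, W q = (∑ j, ∑ l ∈ Finset.Ioi j, Real.log ((q j)^2 - (q l)^2))
        + γ * (∑ j, Real.log (q j)) - (1/2) * (∑ j, (q j)^2)) :
    ∀ q : Fin r → ℝ, (∀ j, q j ≠ 0) → (Function.Injective fun j => (q j)^2) →
      -(ℏ^2/2) * (∑ j, pd (pd φ j) j q) - ℏ * (∑ j, pd W j q * pd φ j q)
        = 2 * (k : ℝ) * ℏ * φ q := by
  intro q hq hinj
  set c : ℕ → ℝ := fun l => (-1 : ℝ) ^ l * ((r + l - k).choose l : ℝ)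
    * (∏ m ∈ Finset.range l, ((r : ℝ) - k + γ + ℏ / 2 + m)) with hc
  set E : ℕ → (Fin r → ℝ) → ℝ := fun m q => esymOn univ m fun i => q i ^ 2 with hE
  have hφE : φ = fun q => ∑ l ∈ Finset.range (k + 1), c l * E (k - l) q := funext hφ
  have hpd : ∀ j, pd φ j = fun q => ∑ l ∈ Finset.range (k + 1), c l * pd (E (k - l)) j q :=
    fun j => hφE ▸ pd_sum_mul _ c (fun l => differentiable_esymOn_sq univ (k - l)) j
  have hpd2 : ∀ j, pd (pd φ j) j
      = fun q => ∑ l ∈ Finset.range (k + 1), c l * pd (pd (E (k - l)) j) j q := fun j => by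
    rw [hpd]
    exact pd_sum_mul _ c (fun l => differentiable_pd_esymOn_sq (k - l) j) j
  have hWq : ∀ j, pd W j q
      = ∑ l ∈ univ.erase j, 2 * q j / (q j ^ 2 - q l ^ 2) + γ / q j - q j := fun j => by
    rw [show W = _ from funext hW]
    exact pd_calogero_prepotential γ hq hinj j
  have hrec : ∀ l : ℕ, ((l : ℝ) + 1) * c (l + 1)
      = -((r : ℝ) - k + l + 1) * (r - k + l + γ + ℏ / 2) * c l := fun l => by
    simp only [hc, Finset.prod_range_succ, pow_succ]
    linear_combination (-(-1 : ℝ) ^ l * (∏ m ∈ Finset.range l, ((r : ℝ) - k + γ + ℏ / 2 + m))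
      * (r - k + γ + ℏ / 2 + l)) * succ_mul_choose_coeff hk2 l
  have hH : -(ℏ ^ 2 / 2) * (∑ j, pd (pd φ j) j q) - ℏ * (∑ j, pd W j q * pd φ j q)
      = ∑ l ∈ Finset.range (k + 1), c l * (2 * ℏ * (k - l : ℕ) * E (k - l) q
        - 2 * ℏ * (r - (k - l : ℕ) + 1) * (r - (k - l : ℕ) + γ + ℏ / 2)
          * esymOnPred univ (k - l) fun i => q i ^ 2) := by
    simp only [hE, ← calogero_esymOn_sq γ ℏ hq hinj]
    simp only [hpd2]
    simp only [hpd, hWq, hE, mul_sum]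
    rw [sum_comm, sum_comm (s := univ) (t := Finset.range (k + 1)), ← sum_sub_distrib]
    refine sum_congr rfl fun l _ => ?_
    rw [mul_sub, mul_sum, mul_sum]
    congr 1 <;> exact sum_congr rfl fun j _ => by ring
  rw [hH, hφE, ← sub_eq_zero]
  simp only [mul_sum]
  rw [← sum_sub_distrib]
  have hsplit : ∀ l ∈ Finset.range (k + 1), c l * (2 * ℏ * (k - l : ℕ) * E (k - l) q
        - 2 * ℏ * (r - (k - l : ℕ) + 1) * (r - (k - l : ℕ) + γ + ℏ / 2)
          * esymOnPred univ (k - l) fun i => q i ^ 2) - 2 * k * ℏ * (c l * E (k - l) q)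
      = -(2 * ℏ) * (l * c l * E (k - l) q) - 2 * ℏ * ((r - k + l + 1) * (r - k + l + γ + ℏ / 2)
          * c l * esymOnPred univ (k - l) fun i => q i ^ 2) := fun l hl => by
    rw [Nat.cast_sub (Nat.lt_succ_iff.1 (Finset.mem_range.1 hl))]
    ring
  rw [sum_congr rfl hsplit, sum_sub_distrib, ← mul_sum, ← mul_sum, Finset.sum_range_succ',
    Finset.sum_range_succ _ k, Nat.sub_self]
  simp only [esymOnPred, Nat.cast_zero, zero_mul, mul_zero, add_zero]
  rw [mul_sum, mul_sum, ← sum_sub_distrib]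
  refine sum_eq_zero fun l hl => ?_
  have hkl : k - l = (k - (l + 1)) + 1 := by have := Finset.mem_range.1 hl; omega
  rw [hkl, Nat.cast_succ, hrec]
  simp only [hE]
  ring
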